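/- arXiv:2011.01091 — 2 statements merged into one kernel-verified Lean document; each statement's English description precedes it below -/
import Mathlib

section
/- Let Ω ⊂ ℝ² be open and bounded with smooth boundary and diameter d_Ω, let γ ≥ 0, let t > 2, and let f : Ω → ℝ be continuous and square-integrable with f ≥ 0 on Ω. Let u be a classical solution: u is C⁴ on an open neighborhood of the closure of Ω, u = 0 and ∇u = 0 at every point of ∂Ω, and Δ²u(x) − γΔu(x) = f(x) for every x ∈ Ω. Then there exists a constant c > 0, independent of γ, f and u, such that ( ∫_Ω |∇u|^t dx )^{1/t} ≤ c · d_Ω^{2/t} · ( ∫_Ω f u dx )^{1/2}. -/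
open MeasureTheory Metric Set Bornology

/-- Partial derivative in the `i`-th coordinate direction. -/
noncomputable def pd {N : ℕ} (i : Fin N) (u : EuclideanSpace ℝ (Fin N) → ℝ) :
    EuclideanSpace ℝ (Fin N) → ℝ :=
  fun x => fderiv ℝ u x (EuclideanSpace.single i 1)

/-- The Laplacian `Δu = ∑ i ∂²u/∂xᵢ²`. -/
noncomputable def lap {N : ℕ} (u : EuclideanSpace ℝ (Fin N) → ℝ) :
    EuclideanSpace ℝ (Fin N) → ℝ :=
  fun x => ∑ i : Fin N, pd i (pd i u) x

/-- `Ω` has smooth boundary. -/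
def HasSmoothBoundary {N : ℕ} (Ω : Set (EuclideanSpace ℝ (Fin N))) : Prop :=
  ∃ Φ : EuclideanSpace ℝ (Fin N) → ℝ, ContDiff ℝ (⊤ : ℕ∞) Φ ∧
    Ω = Φ ⁻¹' Set.Iio 0 ∧ frontier Ω = Φ ⁻¹' {0} ∧
    ∀ x ∈ frontier Ω, fderiv ℝ Φ x ≠ 0

section Helpers

open Filter Topology
open scoped NNReal ENNReal

abbrev E2 := EuclideanSpace ℝ (Fin 2)

lemma ext_hasFDerivAt {Ω U : Set E2} {g : E2 → ℝ} (hΩ : IsOpen Ω) (hU : IsOpen U)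
    (hsub : closure Ω ⊆ U) (hg : ContDiffOn ℝ 1 g U) (h0 : ∀ x ∈ frontier Ω, g x = 0)
    (h1 : ∀ x ∈ frontier Ω, fderiv ℝ g x = 0) (x : E2) :
    HasFDerivAt (Ω.indicator g) (Ω.indicator (fderiv ℝ g) x) x := by
  by_cases hx : x ∈ Ω
  · have hd : DifferentiableAt ℝ g x :=
      (hg.contDiffAt (hU.mem_nhds (hsub (subset_closure hx)))).differentiableAt (by simp)
    rw [indicator_of_mem hx]
    refine hd.hasFDerivAt.congr_of_eventuallyEq ?_
    filter_upwards [hΩ.mem_nhds hx] with y hy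
    simp [hy]
  · rw [indicator_of_notMem hx]
    by_cases hc : x ∈ closure Ω
    · have hf : x ∈ frontier Ω := by
        rw [hΩ.frontier_eq]; exact ⟨hc, hx⟩
      have hd : DifferentiableAt ℝ g x :=
        (hg.contDiffAt (hU.mem_nhds (hsub hc))).differentiableAt (by simp)
      have h := hd.hasFDerivAt
      rw [h1 x hf] at h
      rw [hasFDerivAt_iff_isLittleO] at h ⊢
      refine Asymptotics.IsBigO.trans_isLittleO ?_ h
      refine Asymptotics.IsBigO.of_bound 1 (Eventually.of_forall fun y => ?_)
      by_cases hy : y ∈ Ω <;> simp [hy, hx, h0 x hf]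
    · have : HasFDerivAt (fun _ : E2 => (0:ℝ)) (0 : E2 →L[ℝ] ℝ) x := hasFDerivAt_const _ _
      refine this.congr_of_eventuallyEq ?_
      filter_upwards [isClosed_closure.isOpen_compl.mem_nhds hc] with y hy
      have : y ∉ Ω := fun h => hy (subset_closure h)
      simp [this]

lemma ext_fderiv {Ω U : Set E2} {g : E2 → ℝ} (hΩ : IsOpen Ω) (hU : IsOpen U)
    (hsub : closure Ω ⊆ U) (hg : ContDiffOn ℝ 1 g U) (h0 : ∀ x ∈ frontier Ω, g x = 0)
    (h1 : ∀ x ∈ frontier Ω, fderiv ℝ g x = 0) :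
    fderiv ℝ (Ω.indicator g) = Ω.indicator (fderiv ℝ g) :=
  funext fun x => (ext_hasFDerivAt hΩ hU hsub hg h0 h1 x).fderiv

lemma ext_contDiff {Ω U : Set E2} {g : E2 → ℝ} (hΩ : IsOpen Ω) (hU : IsOpen U)
    (hsub : closure Ω ⊆ U) (hg : ContDiffOn ℝ 1 g U) (h0 : ∀ x ∈ frontier Ω, g x = 0)
    (h1 : ∀ x ∈ frontier Ω, fderiv ℝ g x = 0) :
    ContDiff ℝ 1 (Ω.indicator g) := by
  rw [contDiff_one_iff_fderiv]
  refine ⟨fun x => (ext_hasFDerivAt hΩ hU hsub hg h0 h1 x).differentiableAt, ?_⟩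
  rw [ext_fderiv hΩ hU hsub hg h0 h1]
  exact continuous_indicator h1 ((hg.continuousOn_fderiv_of_isOpen hU le_rfl).mono hsub)

lemma ext_integral {Ω U : Set E2} {g : E2 → ℝ} (hΩ : IsOpen Ω) (hΩb : IsBounded Ω) (hU : IsOpen U)
    (hsub : closure Ω ⊆ U) (hg : ContDiffOn ℝ 1 g U) (h0 : ∀ x ∈ frontier Ω, g x = 0)
    (h1 : ∀ x ∈ frontier Ω, fderiv ℝ g x = 0) (v : E2) :
    ∫ x in Ω, fderiv ℝ g x v = 0 := by
  have hC := ext_contDiff hΩ hU hsub hg h0 h1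
  have hs : HasCompactSupport (Ω.indicator g) := by
    refine HasCompactSupport.intro hΩb.isCompact_closure fun x hx => ?_
    exact indicator_of_notMem (fun h => hx (subset_closure h)) _
  have hc' : Continuous fun x => fderiv ℝ (Ω.indicator g) x v :=
    (hC.continuous_fderiv one_ne_zero).clm_apply continuous_const
  have hs' : HasCompactSupport fun x => fderiv ℝ (Ω.indicator g) x v :=
    hs.fderiv_apply ℝ v
  have := integral_mul_fderiv_eq_neg_fderiv_mul_of_integrable (μ := (volume : Measure E2))
    (f := fun _ => (1:ℝ)) (g := Ω.indicator g) (v := v) (by simp)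
    (by simpa using hc'.integrable_of_hasCompactSupport hs')
    (by simpa using hC.continuous.integrable_of_hasCompactSupport hs)
    (fun x _ => by fun_prop) (fun x _ => (hC.differentiable (by simp)) x)
  simp only [one_mul, fderiv_fun_const, Pi.zero_apply, _root_.zero_apply, zero_mul,
    integral_zero, neg_zero] at this
  rw [ext_fderiv hΩ hU hsub hg h0 h1] at this
  rw [← integral_indicator hΩ.measurableSet, ← this]
  congr 1
  ext x
  by_cases hx : x ∈ Ω <;> simp [hx]

noncomputable def eta (ε s : ℝ) : ℝ := s ^ 3 / (s ^ 2 + ε ^ 2)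
noncomputable def etad (ε s : ℝ) : ℝ := (s ^ 4 + 3 * ε ^ 2 * s ^ 2) / (s ^ 2 + ε ^ 2) ^ 2

lemma eta_hasDerivAt {ε : ℝ} (hε : 0 < ε) (s : ℝ) : HasDerivAt (eta ε) (etad ε s) s := by
  have hp : s ^ 2 + ε ^ 2 ≠ 0 := by positivity
  have := ((hasDerivAt_id s).pow 3).div (((hasDerivAt_id s).pow 2).add_const (ε ^ 2)) hp
  refine HasDerivAt.congr_deriv this ?_
  simp only [etad, id, Pi.pow_apply]
  congr 1
  push_cast
  ring

lemma eta_contDiff {ε : ℝ} (hε : 0 < ε) : ContDiff ℝ 1 (eta ε) := by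
  unfold eta
  exact ContDiff.div (by fun_prop) (by fun_prop) (fun s => by positivity)

lemma eta_sub {ε : ℝ} (hε : 0 < ε) (s : ℝ) : |s - eta ε s| ≤ ε := by
  have hp : 0 < s ^ 2 + ε ^ 2 := by positivity
  have : s - eta ε s = ε ^ 2 * s / (s ^ 2 + ε ^ 2) := by
    unfold eta; field_simp; ring
  rw [this, abs_div, abs_of_pos hp, div_le_iff₀ hp, abs_mul, abs_of_pos (by positivity : 0 < ε ^ 2)]
  rw [← sq_abs s]
  nlinarith [sq_nonneg (|s| - ε), abs_nonneg s, mul_nonneg hε.le (sq_nonneg (|s| - ε)),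
    mul_nonneg hε.le (sq_nonneg (|s|)), mul_nonneg (sq_nonneg ε) (abs_nonneg s)]

lemma etad_bound {ε : ℝ} (hε : 0 < ε) (s : ℝ) : |etad ε s| ≤ 2 := by
  unfold etad
  have hp : 0 < s ^ 2 + ε ^ 2 := by positivity
  rw [abs_of_nonneg (by positivity), div_le_iff₀ (by positivity)]
  nlinarith [sq_nonneg (s ^ 2), sq_nonneg (ε ^ 2), mul_nonneg (sq_nonneg s) (sq_nonneg ε)]

lemma eta_zero (ε : ℝ) : eta ε 0 = 0 := by simp [eta]
lemma etad_zero (ε : ℝ) : etad ε 0 = 0 := by simp [etad]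

lemma etad_tendsto {s : ℝ} (hs : s ≠ 0) {e : ℕ → ℝ} (he : Tendsto e atTop (𝓝 0)) :
    Tendsto (fun n => etad (e n) s) atTop (𝓝 1) := by
  have hc : ContinuousAt (fun ε => etad ε s) 0 := by
    unfold etad
    refine ContinuousAt.div (by fun_prop) (by fun_prop) (by positivity)
  have := hc.tendsto.comp he
  have h1 : etad 0 s = 1 := by unfold etad; field_simp; ring
  rwa [h1] at this

lemma comp_eta_hasFDerivAt {ε : ℝ} (hε : 0 < ε) {U : Set E2} {g : E2 → ℝ} (hU : IsOpen U)
    (hg : ContDiffOn ℝ 1 g U) {x : E2} (hx : x ∈ U) :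
    fderiv ℝ (fun y => eta ε (g y)) x = etad ε (g x) • fderiv ℝ g x := by
  have hd : DifferentiableAt ℝ g x :=
      (hg.contDiffAt (hU.mem_nhds hx)).differentiableAt (by simp)
  exact ((eta_hasDerivAt hε (g x)).comp_hasFDerivAt x hd.hasFDerivAt).fderiv

/-- the zero set of a C^1 function with nonvanishing directional derivative is null -/
lemma null_zero_set {U : Set E2} {g : E2 → ℝ} (hU : IsOpen U)
    (hg : ContDiffOn ℝ 1 g U) (v : E2) :
    ∀ᵐ x : E2, ¬ (x ∈ U ∧ g x = 0 ∧ fderiv ℝ g x v ≠ 0) := by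
  have hdv : ContinuousOn (fun x => fderiv ℝ g x v) U :=
    (hg.continuousOn_fderiv_of_isOpen hU le_rfl).clm_apply continuousOn_const
  have hm : MeasurableSet {x | ¬ (x ∈ U ∧ g x = 0 ∧ fderiv ℝ g x v ≠ 0)} := by
    have h1 : IsOpen (U ∩ (fun x => fderiv ℝ g x v) ⁻¹' {0}ᶜ) :=
      hdv.isOpen_inter_preimage hU isOpen_compl_singleton
    have h2 : IsOpen (U ∩ g ⁻¹' {0}ᶜ) :=
      hg.continuousOn.isOpen_inter_preimage hU isOpen_compl_singleton
    have : {x | ¬ (x ∈ U ∧ g x = 0 ∧ fderiv ℝ g x v ≠ 0)} =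
       ((U ∩ (fun x => fderiv ℝ g x v) ⁻¹' {0}ᶜ) \ (U ∩ g ⁻¹' {0}ᶜ))ᶜ := by
      ext x
      simp only [mem_ofPred_eq, mem_compl_iff, Set.mem_sdiff, mem_inter_iff, mem_preimage,
        mem_singleton_iff]
      tauto
    rw [this]
    exact (h1.measurableSet.diff h2.measurableSet).compl
  refine ae_mem_of_ae_add_linearMap_mem (LinearMap.toSpanSingleton ℝ E2 v)
    (volume : Measure ℝ) (volume : Measure E2) hm fun y => ?_
  set S : Set ℝ := {t | y + t • v ∈ U ∧ g (y + t • v) = 0 ∧ fderiv ℝ g (y + t • v) v ≠ 0} with hS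
  have hcount : S.Countable := by
    have hdis : DiscreteTopology S := by
      rw [discreteTopology_subtype_iff]
      rintro t ⟨h1, h2, h3⟩
      have hd : DifferentiableAt ℝ g (y + t • v) :=
        (hg.contDiffAt (hU.mem_nhds h1)).differentiableAt (by simp)
      have hl : HasDerivAt (fun t : ℝ => y + t • v) v t := by
        simpa using ((hasDerivAt_id t).smul_const v).const_add y
      have := (hd.hasFDerivAt.comp_hasDerivAt t hl).eventually_ne (c := 0) h3
      have hh : Sᶜ ∈ 𝓝[≠] t := by
        filter_upwards [this] with z hz hzS using hz hzS.2.1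
      rwa [Filter.mem_iff_inf_principal_compl, compl_compl] at hh
    exact (Set.countable_coe_iff).1 (TopologicalSpace.separableSpace_iff_countable.1 inferInstance)
  have := hcount.ae_notMem (volume : Measure ℝ)
  filter_upwards [this] with t ht
  exact fun h => ht h


lemma contOn_integrableOn {Ω U : Set E2} (hΩb : IsBounded Ω) (hsub : closure Ω ⊆ U) {g : E2 → ℝ}
    (hg : ContinuousOn g U) : IntegrableOn g Ω :=
  ((hg.mono hsub).integrableOn_compact hΩb.isCompact_closure).mono_set subset_closure

lemma comp_eta_contDiffOn {ε : ℝ} (hε : 0 < ε) {U : Set E2} {g : E2 → ℝ}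
    (hg : ContDiffOn ℝ 1 g U) : ContDiffOn ℝ 1 (fun y => eta ε (g y)) U :=
  (eta_contDiff hε).comp_contDiffOn hg

/-- Divergence theorem for functions vanishing on the boundary. -/
lemma integral_pd {Ω U : Set E2} {g : E2 → ℝ} (hΩ : IsOpen Ω) (hΩb : IsBounded Ω) (hU : IsOpen U)
    (hsub : closure Ω ⊆ U) (hg : ContDiffOn ℝ 1 g U) (h0 : ∀ x ∈ frontier Ω, g x = 0) (v : E2) :
    ∫ x in Ω, fderiv ℝ g x v = 0 := by
  have hdv : ContinuousOn (fun x => fderiv ℝ g x v) U :=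
    (hg.continuousOn_fderiv_of_isOpen hU le_rfl).clm_apply continuousOn_const
  have hsubΩ : Ω ⊆ U := subset_closure.trans hsub
  have hint := contOn_integrableOn hΩb hsub hdv
  let e : ℕ → ℝ := fun n => 1 / ((n : ℝ) + 1)
  have he : Tendsto e atTop (𝓝 0) := tendsto_one_div_add_atTop_nhds_zero_nat
  have hepos : ∀ n, 0 < e n := fun n => by positivity
  have hz : ∀ n, ∫ x in Ω, etad (e n) (g x) * fderiv ℝ g x v = 0 := by
    intro n
    have := ext_integral hΩ hΩb hU hsub (comp_eta_contDiffOn (hepos n) hg)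
      (fun x hx => by rw [h0 x hx, eta_zero])
      (fun x hx => by
        rw [comp_eta_hasFDerivAt (hepos n) hU hg (hsub (frontier_subset_closure hx)), h0 x hx,
          etad_zero, zero_smul]) v
    rw [← this]
    refine setIntegral_congr_fun hΩ.measurableSet fun x hx => ?_
    simp only [comp_eta_hasFDerivAt (hepos n) hU hg (hsubΩ hx)]
    simp
  have hlim : Tendsto (fun n => ∫ x in Ω, etad (e n) (g x) * fderiv ℝ g x v) atTop
      (𝓝 (∫ x in Ω, fderiv ℝ g x v)) := by
    refine tendsto_integral_of_dominated_convergence (fun x => 2 * ‖fderiv ℝ g x v‖) ?_ ?_ ?_ ?_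
    · intro n
      refine ContinuousOn.aestronglyMeasurable ?_ hΩ.measurableSet
      refine ContinuousOn.mul ?_ (hdv.mono hsubΩ)
      have : Continuous (etad (e n)) := by
        unfold etad
        have := hepos n
        exact Continuous.div (by fun_prop) (by fun_prop) (fun s => by positivity)
      exact this.comp_continuousOn (hg.continuousOn.mono hsubΩ)
    · exact hint.norm.const_mul 2
    · intro n
      refine Eventually.of_forall fun x => ?_
      rw [norm_mul]
      exact mul_le_mul_of_nonneg_right (etad_bound (hepos n) _) (norm_nonneg _)
    · filter_upwards [ae_restrict_of_ae (null_zero_set hU hg v), ae_restrict_mem hΩ.measurableSet]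
        with x hx hxΩ
      by_cases hgx : g x = 0
      · have : fderiv ℝ g x v = 0 := by
          by_contra h
          exact hx ⟨hsubΩ hxΩ, hgx, h⟩
        simp [this]
      · simpa using (etad_tendsto hgx he).mul_const (fderiv ℝ g x v)
  simp only [hz] at hlim
  exact (tendsto_nhds_unique hlim tendsto_const_nhds)

/-- Sobolev inequality for functions vanishing on the boundary. -/
lemma sobolev {Ω : Set E2} (hΩ : IsOpen Ω) (hΩb : IsBounded Ω) (t : ℝ≥0) (ht : 2 < t) :
    ∃ C : ℝ≥0, ∀ (U : Set E2) (g : E2 → ℝ), IsOpen U → closure Ω ⊆ U → ContDiffOn ℝ 1 g U →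
      (∀ x ∈ frontier Ω, g x = 0) →
      eLpNorm g t (volume.restrict Ω) ≤ C * eLpNorm (fderiv ℝ g) 2 (volume.restrict Ω) := by
  have ht0 : (0:ℝ) < t := by
    have : (2:ℝ) < t := by exact_mod_cast ht
    linarith
  have ht2 : (2:ℝ) < t := by exact_mod_cast ht
  have hvol : volume Ω ≠ ∞ := hΩb.measure_lt_top.ne
  let p : ℝ≥0 := 2 * t / (t + 2)
  have hp1 : 1 ≤ p := by
    rw [← NNReal.coe_le_coe]
    simp only [p]; push_cast
    rw [le_div_iff₀ (by positivity)]; linarith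
  have hp2 : p < 2 := by
    rw [← NNReal.coe_lt_coe]
    simp only [p]; push_cast
    rw [div_lt_iff₀ (by positivity)]; linarith
  have hfr : Module.finrank ℝ E2 = 2 := by simp
  let C0 : ℝ≥0 := eLpNormLESNormFDerivOfLeConst ℝ (volume : Measure E2) Ω p t
  let r : ℝ := 1 / (p : ℝ≥0∞).toReal - 1 / (2 : ℝ≥0∞).toReal
  have hr : 0 ≤ r := by
    have : (p:ℝ) ≤ 2 := by exact_mod_cast hp2.le
    have h1 : (1:ℝ) ≤ p := by exact_mod_cast hp1
    simp only [r, ENNReal.coe_toReal, ENNReal.toReal_ofNat, sub_nonneg]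
    exact one_div_le_one_div_of_le (by linarith) this
  let V : ℝ≥0 := ((volume Ω) ^ r).toNNReal
  have hV : (V : ℝ≥0∞) = (volume Ω) ^ r := ENNReal.coe_toNNReal (by finiteness)
  refine ⟨C0 * (2 * V), fun U g hU hsub hg h0 => ?_⟩
  have hsubΩ : Ω ⊆ U := subset_closure.trans hsub
  set B : ℝ≥0∞ := ((C0 * (2 * V) : ℝ≥0) : ℝ≥0∞) * eLpNorm (fderiv ℝ g) 2 (volume.restrict Ω)
  have key : ∀ ε : ℝ, 0 < ε → eLpNorm g t (volume.restrict Ω) ≤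
      B + (volume Ω) ^ ((t : ℝ≥0∞).toReal)⁻¹ * ENNReal.ofReal ε := by
    intro ε hε
    have hge := comp_eta_contDiffOn hε hg
    have h0' : ∀ x ∈ frontier Ω, eta ε (g x) = 0 := fun x hx => by rw [h0 x hx, eta_zero]
    have h1' : ∀ x ∈ frontier Ω, fderiv ℝ (fun y => eta ε (g y)) x = 0 := fun x hx => by
        rw [comp_eta_hasFDerivAt hε hU hg (hsub (frontier_subset_closure hx)), h0 x hx,
          etad_zero, zero_smul]
    have hC := ext_contDiff hΩ hU hsub hge h0' h1'
    have hS := eLpNorm_le_eLpNorm_fderiv_of_le (volume : Measure E2) hC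
      (s := Ω) support_indicator_subset hp1 (q := t)
      (by rw [hfr]; exact_mod_cast hp2)
      (by
        rw [hfr]; simp only [p]; push_cast
        have : (t:ℝ) ≠ 0 := ht0.ne'
        apply le_of_eq; field_simp; ring) hΩb
    rw [ext_fderiv hΩ hU hsub hge h0' h1', eLpNorm_indicator_eq_eLpNorm_restrict hΩ.measurableSet] at hS
    have hI := eLpNorm_indicator_eq_eLpNorm_restrict (μ := (volume : Measure E2)) (p := (p : ℝ≥0∞))
      (f := fderiv ℝ (fun y => eta ε (g y))) hΩ.measurableSet
    replace hS := hS.trans (mul_le_mul_right hI.le _)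
    have hmeas : AEStronglyMeasurable (fderiv ℝ fun y => eta ε (g y)) (volume.restrict Ω) :=
      ContinuousOn.aestronglyMeasurable
        ((hge.continuousOn_fderiv_of_isOpen hU le_rfl).mono hsubΩ) hΩ.measurableSet
    have hH := eLpNorm_le_eLpNorm_mul_rpow_measure_univ
      (μ := volume.restrict Ω) (p := (p : ℝ≥0∞)) (q := 2) (by exact_mod_cast hp2.le) hmeas
    have hE : eLpNorm (fderiv ℝ fun y => eta ε (g y)) 2 (volume.restrict Ω) ≤
        (2 : ℝ≥0) • eLpNorm (fderiv ℝ g) 2 (volume.restrict Ω) := by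
      refine eLpNorm_le_nnreal_smul_eLpNorm_of_ae_le_mul ?_ _
      filter_upwards [ae_restrict_mem hΩ.measurableSet] with x hx
      rw [comp_eta_hasFDerivAt hε hU hg (hsubΩ hx), nnnorm_smul]
      gcongr
      exact etad_bound hε _
    rw [Measure.restrict_apply_univ, ← hV] at hH
    have h1 : eLpNorm (fun y => eta ε (g y)) t (volume.restrict Ω) ≤ B := by
      refine hS.trans ?_
      calc _ ≤ (C0 : ℝ≥0∞) * (((2 : ℝ≥0) • eLpNorm (fderiv ℝ g) 2 (volume.restrict Ω)) * V) := by
            gcongr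
            exact hH.trans (by gcongr)
        _ = B := by
            simp only [B, ENNReal.smul_def, smul_eq_mul]; push_cast; ring
    have h2 : eLpNorm (fun y => g y - eta ε (g y)) t (volume.restrict Ω) ≤
        (volume Ω) ^ ((t : ℝ≥0∞).toReal)⁻¹ * ENNReal.ofReal ε := by
      have := eLpNorm_le_of_ae_bound (μ := volume.restrict Ω) (p := (t : ℝ≥0∞))
        (f := fun y => g y - eta ε (g y)) (C := ε) (Eventually.of_forall fun x => eta_sub hε (g x))
      rwa [Measure.restrict_apply_univ] at this
    have h3 : g = (fun y => eta ε (g y)) + (fun y => g y - eta ε (g y)) := by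
      ext y; simp
    calc eLpNorm g t (volume.restrict Ω) 
        = eLpNorm ((fun y => eta ε (g y)) + (fun y => g y - eta ε (g y))) t (volume.restrict Ω) := by
          rw [← h3]
      _ ≤ _ := eLpNorm_add_le
          (ContinuousOn.aestronglyMeasurable (hge.continuousOn.mono hsubΩ) hΩ.measurableSet)
          (ContinuousOn.aestronglyMeasurable
            ((hg.continuousOn.sub hge.continuousOn).mono hsubΩ) hΩ.measurableSet)
          (by exact_mod_cast (le_trans (by norm_num) ht.le : (1:ℝ≥0) ≤ t))
      _ ≤ _ := add_le_add h1 h2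
  have hlim : Tendsto (fun n : ℕ => B + (volume Ω) ^ ((t : ℝ≥0∞).toReal)⁻¹ *
      ENNReal.ofReal (1 / ((n:ℝ) + 1))) atTop (𝓝 (B + (volume Ω) ^ ((t : ℝ≥0∞).toReal)⁻¹ *
      ENNReal.ofReal 0)) := by
    refine Tendsto.const_add _ (ENNReal.Tendsto.const_mul ?_ (Or.inr ?_))
    · exact ENNReal.tendsto_ofReal tendsto_one_div_add_atTop_nhds_zero_nat
    · finiteness
  rw [ENNReal.ofReal_zero, mul_zero, add_zero] at hlim
  exact ge_of_tendsto' hlim fun n => key _ (by positivity)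


lemma pd_contDiffOn {U : Set E2} {g : E2 → ℝ} (hU : IsOpen U) {m n : WithTop ℕ∞}
    (hg : ContDiffOn ℝ n g U) (h : m + 1 ≤ n) (i : Fin 2) : ContDiffOn ℝ m (pd i g) U :=
  (hg.fderiv_of_isOpen hU h).clm_apply contDiffOn_const

lemma mul_integrableOn {Ω U : Set E2} (hΩb : IsBounded Ω) (hsub : closure Ω ⊆ U) {g h : E2 → ℝ}
    (hg : ContinuousOn g U) (hh : ContinuousOn h U) : IntegrableOn (fun x => g x * h x) Ω :=
  contOn_integrableOn hΩb hsub (hg.mul hh)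

lemma ibp {Ω U : Set E2} {a b : E2 → ℝ} (hΩ : IsOpen Ω) (hΩb : IsBounded Ω) (hU : IsOpen U)
    (hsub : closure Ω ⊆ U) (ha : ContDiffOn ℝ 1 a U) (hb : ContDiffOn ℝ 1 b U)
    (h0 : ∀ x ∈ frontier Ω, a x = 0) (i : Fin 2) :
    ∫ x in Ω, a x * pd i b x = - ∫ x in Ω, pd i a x * b x := by
  have hsubΩ : Ω ⊆ U := subset_closure.trans hsub
  have h := integral_pd hΩ hΩb hU hsub (ha.mul hb) (fun x hx => by simp [h0 x hx])
    (EuclideanSpace.single i 1)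
  have hpa := (pd_contDiffOn hU ha (m := 0) (by simp) i).continuousOn
  have hpb := (pd_contDiffOn hU hb (m := 0) (by simp) i).continuousOn
  have h1 := mul_integrableOn hΩb hsub ha.continuousOn hpb
  have h2 := mul_integrableOn hΩb hsub hpa hb.continuousOn
  rw [eq_neg_iff_add_eq_zero, ← integral_add h1 h2, ← h]
  refine setIntegral_congr_fun hΩ.measurableSet fun x hx => ?_
  have hda : DifferentiableAt ℝ a x :=
    (ha.contDiffAt (hU.mem_nhds (hsubΩ hx))).differentiableAt (by simp)
  have hdb : DifferentiableAt ℝ b x :=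
    (hb.contDiffAt (hU.mem_nhds (hsubΩ hx))).differentiableAt (by simp)
  have h3 : fderiv ℝ (fun x => a x * b x) x (EuclideanSpace.single i 1) =
      a x * pd i b x + b x * pd i a x := by
    change fderiv ℝ (a * b) x _ = _
    rw [(hda.hasFDerivAt.mul hdb.hasFDerivAt).fderiv]
    rfl
  simp only [h3]
  ring

lemma pd_comm {U : Set E2} {g : E2 → ℝ} (hU : IsOpen U) (hg : ContDiffOn ℝ 2 g U) (i j : Fin 2)
    {x : E2} (hx : x ∈ U) : pd i (pd j g) x = pd j (pd i g) x := by
  have hc := hg.contDiffAt (hU.mem_nhds hx)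
  have hs := hc.isSymmSndFDerivAt (by simp)
  have hd : DifferentiableAt ℝ (fderiv ℝ g) x :=
    (hc.fderiv_right (m := 1) (by norm_num)).differentiableAt (by simp)
  have e : ∀ k l : Fin 2, pd k (pd l g) x =
      fderiv ℝ (fderiv ℝ g) x (EuclideanSpace.single k 1) (EuclideanSpace.single l 1) := by
    intro k l
    have := (hd.hasFDerivAt.clm_apply (hasFDerivAt_const (EuclideanSpace.single l (1:ℝ)) x)).fderiv
    change fderiv ℝ (fun y => fderiv ℝ g y (EuclideanSpace.single l 1)) x _ = _
    rw [this]
    simp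
  rw [e, e]
  exact hs _ _

lemma gradient_coord (g : E2 → ℝ) (x : E2) (i : Fin 2) : gradient g x i = pd i g x := by
  have h : inner ℝ (gradient g x) (EuclideanSpace.single i (1:ℝ)) = pd i g x := by
    simp [gradient, pd]
  rw [EuclideanSpace.inner_single_right] at h
  simpa using h

lemma norm_gradient_eq (g : E2 → ℝ) (x : E2) : ‖gradient g x‖ = ‖fderiv ℝ g x‖ := by
  simp [gradient]

lemma norm_gradient_sq (g : E2 → ℝ) (x : E2) :
    ‖gradient g x‖ ^ 2 = pd 0 g x ^ 2 + pd 1 g x ^ 2 := by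
  rw [EuclideanSpace.norm_sq_eq]
  simp [gradient_coord]

lemma memLp_of_cont {F : Type*} [NormedAddCommGroup F] {Ω U : Set E2} (hΩ : IsOpen Ω)
    (hΩb : IsBounded Ω) [SecondCountableTopologyEither E2 F]
    (hsub : closure Ω ⊆ U) {g : E2 → F} (hg : ContinuousOn g U) (p : ℝ≥0∞) :
    MemLp g p (volume.restrict Ω) := by
  obtain ⟨C, hC⟩ := hΩb.isCompact_closure.exists_bound_of_continuousOn (hg.mono hsub)
  have : IsFiniteMeasure ((volume : Measure E2).restrict Ω) :=
    ⟨by rw [Measure.restrict_apply_univ]; exact hΩb.measure_lt_top⟩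
  refine MemLp.of_bound (ContinuousOn.aestronglyMeasurable
    (hg.mono (subset_closure.trans hsub)) hΩ.measurableSet) C ?_
  filter_upwards [ae_restrict_mem hΩ.measurableSet] with x hx using hC x (subset_closure hx)

/-- Energy estimate. -/
lemma energy {Ω U : Set E2} {f u : E2 → ℝ} {γ : ℝ} (hγ : 0 ≤ γ) (hΩ : IsOpen Ω)
    (hΩb : IsBounded Ω) (hU : IsOpen U)
    (hsub : closure Ω ⊆ U) (hu : ContDiffOn ℝ 4 u U)
    (h0 : ∀ x ∈ frontier Ω, u x = 0) (h1 : ∀ x ∈ frontier Ω, gradient u x = 0)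
    (he : ∀ x ∈ Ω, lap (lap u) x - γ * lap u x = f x) (i : Fin 2) :
    ∫ x in Ω, ‖fderiv ℝ (pd i u) x‖ ^ 2 ≤ ∫ x in Ω, f x * u x := by
  have hsubΩ : Ω ⊆ U := subset_closure.trans hsub
  have hp : ∀ i, ContDiffOn ℝ 3 (pd i u) U := fun i => pd_contDiffOn hU hu (by norm_num) i
  have hpp : ∀ i j, ContDiffOn ℝ 2 (pd i (pd j u)) U :=
    fun i j => pd_contDiffOn hU (hp j) (by norm_num) i
  have hL : ContDiffOn ℝ 2 (lap u) U := ContDiffOn.sum fun i _ => hpp i i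
  have hpL : ∀ i, ContDiffOn ℝ 1 (pd i (lap u)) U := fun i => pd_contDiffOn hU hL (by norm_num) i
  have hppL : ∀ i, ContinuousOn (pd i (pd i (lap u))) U :=
    fun i => (pd_contDiffOn hU (hpL i) (m := 0) (by simp) i).continuousOn
  have hu1 : ContDiffOn ℝ 1 u U := hu.of_le (by norm_num)
  have hp1 : ∀ i, ContDiffOn ℝ 1 (pd i u) U := fun i => (hp i).of_le (by norm_num)
  have hL1 : ContDiffOn ℝ 1 (lap u) U := hL.of_le (by norm_num)
  have hpp1 : ∀ i j, ContDiffOn ℝ 1 (pd i (pd j u)) U := fun i j => (hpp i j).of_le (by norm_num)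
  have hb : ∀ i, ∀ x ∈ frontier Ω, pd i u x = 0 := fun i x hx => by
    rw [← gradient_coord, h1 x hx]; simp
  have cu := hu1.continuousOn
  have cp := fun i => (hp1 i).continuousOn
  have cpp := fun i j => (hpp1 i j).continuousOn
  have cL := hL1.continuousOn
  have cpL := fun i => (hpL i).continuousOn
  have I := fun {g : E2 → ℝ} (hg : ContinuousOn g U) => contOn_integrableOn hΩb hsub hg
  have J := fun {g h : E2 → ℝ} (hg : ContinuousOn g U) (hh : ContinuousOn h U) =>
    mul_integrableOn hΩb hsub hg hh
  -- u Δ² u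
  have A1 : ∀ i, ∫ x in Ω, u x * pd i (pd i (lap u)) x = ∫ x in Ω, pd i (pd i u) x * lap u x := by
    intro i
    rw [ibp hΩ hΩb hU hsub hu1 (hpL i) h0 i, ibp hΩ hΩb hU hsub (hp1 i) hL1 (hb i) i, neg_neg]
  have A2 : ∀ i, ∫ x in Ω, u x * pd i (pd i u) x = - ∫ x in Ω, pd i u x * pd i u x :=
    fun i => ibp hΩ hΩb hU hsub hu1 (hp1 i) h0 i
  have A3 : ∫ x in Ω, pd 0 (pd 0 u) x * pd 1 (pd 1 u) x =
      ∫ x in Ω, pd 0 (pd 1 u) x * pd 0 (pd 1 u) x := by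
    have e1 := ibp hΩ hΩb hU hsub (hp1 0) (hpp1 1 1) (hb 0) 0
    have e2 := ibp hΩ hΩb hU hsub (hp1 0) (hpp1 0 1) (hb 0) 1
    have e3 : ∫ x in Ω, pd 0 u x * pd 0 (pd 1 (pd 1 u)) x =
        ∫ x in Ω, pd 0 u x * pd 1 (pd 0 (pd 1 u)) x :=
      setIntegral_congr_fun hΩ.measurableSet fun x hx => by
        rw [pd_comm hU ((hp 1).of_le (by norm_num)) 0 1 (hsubΩ hx)]
    have e4 : ∫ x in Ω, pd 1 (pd 0 u) x * pd 0 (pd 1 u) x =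
        ∫ x in Ω, pd 0 (pd 1 u) x * pd 0 (pd 1 u) x :=
      setIntegral_congr_fun hΩ.measurableSet fun x hx => by
        rw [pd_comm hU (hu.of_le (by norm_num)) 1 0 (hsubΩ hx)]
    linarith
  have B1 : ∫ x in Ω, u x * lap (lap u) x = ∫ x in Ω, lap u x * lap u x := by
    have l : ∀ x, u x * lap (lap u) x =
        u x * pd 0 (pd 0 (lap u)) x + u x * pd 1 (pd 1 (lap u)) x := fun x => by
      simp only [lap, Fin.sum_univ_two]; ring
    have r : ∀ x, lap u x * lap u x =
        pd 0 (pd 0 u) x * lap u x + pd 1 (pd 1 u) x * lap u x := fun x => by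
      simp only [lap, Fin.sum_univ_two]; ring
    simp_rw [l, r]
    rw [integral_add (J cu (hppL 0)) (J cu (hppL 1)),
      integral_add (J (cpp 0 0) cL) (J (cpp 1 1) cL), A1, A1]
  have B2 : ∫ x in Ω, u x * lap u x ≤ 0 := by
    have l : ∀ x, u x * lap u x = u x * pd 0 (pd 0 u) x + u x * pd 1 (pd 1 u) x := fun x => by
      simp only [lap, Fin.sum_univ_two]; ring
    simp_rw [l]
    rw [integral_add (J cu (cpp 0 0)) (J cu (cpp 1 1)), A2, A2]
    have n0 : 0 ≤ ∫ x in Ω, pd 0 u x * pd 0 u x := integral_nonneg fun x => mul_self_nonneg _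
    have n1 : 0 ≤ ∫ x in Ω, pd 1 u x * pd 1 u x := integral_nonneg fun x => mul_self_nonneg _
    linarith
  have B3 : ∫ x in Ω, lap u x * lap u x =
      ∫ x in Ω, (pd 0 (pd 0 u) x * pd 0 (pd 0 u) x + pd 1 (pd 1 u) x * pd 1 (pd 1 u) x +
        2 * (pd 0 (pd 1 u) x * pd 0 (pd 1 u) x)) := by
    have l : ∀ x, lap u x * lap u x =
        pd 0 (pd 0 u) x * pd 0 (pd 0 u) x + pd 1 (pd 1 u) x * pd 1 (pd 1 u) x +
        2 * (pd 0 (pd 0 u) x * pd 1 (pd 1 u) x) := fun x => by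
      simp only [lap, Fin.sum_univ_two]; ring
    simp_rw [l]
    have i1 := (J (cpp 0 0) (cpp 0 0)).add (J (cpp 1 1) (cpp 1 1))
    simp only [Pi.add_def] at i1
    have i2 := (J (cpp 0 0) (cpp 1 1)).const_mul 2
    have i3 := (J (cpp 0 1) (cpp 0 1)).const_mul 2
    rw [integral_add i1 i2, integral_add i1 i3, integral_const_mul, integral_const_mul, A3]
  have clapL : ContinuousOn (lap (lap u)) U := continuousOn_finsetSum _ fun i _ => hppL i
  have B4 : ∫ x in Ω, f x * u x =
      (∫ x in Ω, u x * lap (lap u) x) - γ * ∫ x in Ω, u x * lap u x := by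
    rw [← integral_const_mul, ← integral_sub (J cu clapL) ((J cu cL).const_mul γ)]
    refine setIntegral_congr_fun hΩ.measurableSet fun x hx => ?_
    simp only [← he x hx]; ring
  have B5 : ∫ x in Ω, ‖fderiv ℝ (pd i u) x‖ ^ 2 ≤ ∫ x in Ω, lap u x * lap u x := by
    rw [B3]
    have i1 := I ((((cpp 0 0).mul (cpp 0 0)).add ((cpp 1 1).mul (cpp 1 1))).add
      ((continuousOn_const (c := (2:ℝ))).mul ((cpp 0 1).mul (cpp 0 1))))
    refine setIntegral_mono_on ?_ i1 hΩ.measurableSet ?_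
    · exact I (((hp1 i).continuousOn_fderiv_of_isOpen hU le_rfl).norm.pow 2)
    · intro x hx
      rw [← norm_gradient_eq, norm_gradient_sq]
      fin_cases i
      · have := pd_comm hU (hu.of_le (by norm_num)) 1 0 (hsubΩ hx)
        simp only [Fin.zero_eta, this]
        nlinarith [mul_self_nonneg (pd 1 (pd 1 u) x), mul_self_nonneg (pd 0 (pd 1 u) x)]
      · simp only [Fin.mk_one]
        nlinarith [mul_self_nonneg (pd 0 (pd 0 u) x), mul_self_nonneg (pd 0 (pd 1 u) x)]
  have := mul_nonneg hγ (neg_nonneg.2 B2)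
  rw [B4, B1]
  linarith

lemma final_bound {Ω : Set E2} (hΩ : IsOpen Ω) (hΩb : IsBounded Ω) (t : ℝ) (ht : 2 < t) :
    ∃ C : ℝ, 0 ≤ C ∧ ∀ γ : ℝ, 0 ≤ γ → ∀ f u : E2 → ℝ, ∀ U : Set E2,
          IsOpen U → closure Ω ⊆ U → ContDiffOn ℝ 4 u U →
          (∀ x ∈ frontier Ω, u x = 0) →
          (∀ x ∈ frontier Ω, gradient u x = 0) →
          (∀ x ∈ Ω, lap (lap u) x - γ * lap u x = f x) →
          (∫ x in Ω, ‖gradient u x‖ ^ t) ^ (1 / t) ≤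
            C * (∫ x in Ω, f x * u x) ^ ((1 : ℝ) / 2) := by
  lift t to ℝ≥0 using by linarith
  have ht' : 2 < t := by exact_mod_cast ht
  have ht0 : t ≠ 0 := by rintro rfl; simp at ht'
  obtain ⟨C, hC⟩ := sobolev hΩ hΩb t ht'
  refine ⟨2 * C, by positivity, fun γ hγ f u U hU hsub hu h0 h1 he => ?_⟩
  have hsubΩ : Ω ⊆ U := subset_closure.trans hsub
  have hp1 : ∀ i, ContDiffOn ℝ 1 (pd i u) U := fun i => pd_contDiffOn hU hu (by norm_num) i
  have hb : ∀ i, ∀ x ∈ frontier Ω, pd i u x = 0 := fun i x hx => by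
    rw [← gradient_coord, h1 x hx]; simp
  have hcg : ContinuousOn (gradient u) U := by
    have := hu.continuousOn_fderiv_of_isOpen hU (by norm_num)
    exact (InnerProductSpace.toDual ℝ E2).symm.continuous.comp_continuousOn this
  set A : ℝ := ∫ x in Ω, f x * u x with hA
  have hD : ∀ i, eLpNorm (fderiv ℝ (pd i u)) 2 (volume.restrict Ω) ≤
      ENNReal.ofReal (A ^ ((1:ℝ) / 2)) := by
    intro i
    have hm := memLp_of_cont hΩ hΩb hsub ((hp1 i).continuousOn_fderiv_of_isOpen hU le_rfl) 2
    rw [hm.eLpNorm_eq_integral_rpow_norm (by simp) (by simp)]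
    have hen := energy hγ hΩ hΩb hU hsub hu h0 h1 he i
    simp only [ENNReal.toReal_ofNat, Real.rpow_two]
    rw [← one_div]
    apply ENNReal.ofReal_le_ofReal
    exact Real.rpow_le_rpow (integral_nonneg fun x => by positivity) hen (by norm_num)
  have hS : ∀ i, eLpNorm (pd i u) t (volume.restrict Ω) ≤
      C * ENNReal.ofReal (A ^ ((1:ℝ) / 2)) := fun i =>
    (hC U (pd i u) hU hsub (hp1 i) (hb i)).trans (by gcongr; exact hD i)
  have hmg := memLp_of_cont hΩ hΩb hsub hcg t
  have hA0 : 0 ≤ A := le_trans (integral_nonneg fun x => by positivity)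
    (energy hγ hΩ hΩb hU hsub hu h0 h1 he 0)
  have hG : eLpNorm (gradient u) t (volume.restrict Ω) ≤
      ENNReal.ofReal (2 * C * A ^ ((1:ℝ) / 2)) := by
    have m : ∀ i, AEStronglyMeasurable (fun x => ‖pd i u x‖) (volume.restrict Ω) := fun i =>
      ContinuousOn.aestronglyMeasurable (((hp1 i).continuousOn.mono hsubΩ).norm) hΩ.measurableSet
    calc eLpNorm (gradient u) t (volume.restrict Ω)
        ≤ eLpNorm ((fun x => ‖pd 0 u x‖) + fun x => ‖pd 1 u x‖) t (volume.restrict Ω) := by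
          refine eLpNorm_mono fun x => ?_
          simp only [Pi.add_apply]
          rw [Real.norm_of_nonneg (by positivity)]
          refine abs_le_of_sq_le_sq' ?_ (by positivity) |>.2
          rw [norm_gradient_sq]
          simp only [Real.norm_eq_abs]
          nlinarith [sq_abs (pd 0 u x), sq_abs (pd 1 u x), abs_nonneg (pd 0 u x),
            abs_nonneg (pd 1 u x), mul_nonneg (abs_nonneg (pd 0 u x)) (abs_nonneg (pd 1 u x))]
      _ ≤ eLpNorm (fun x => ‖pd 0 u x‖) t (volume.restrict Ω) +
          eLpNorm (fun x => ‖pd 1 u x‖) t (volume.restrict Ω) :=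
          eLpNorm_add_le (m 0) (m 1)
            (by exact_mod_cast (le_trans (by norm_num) ht'.le : (1:ℝ≥0) ≤ t))
      _ ≤ C * ENNReal.ofReal (A ^ ((1:ℝ) / 2)) + C * ENNReal.ofReal (A ^ ((1:ℝ) / 2)) := by
          rw [eLpNorm_norm, eLpNorm_norm]
          exact add_le_add (hS 0) (hS 1)
      _ = ENNReal.ofReal (2 * C * A ^ ((1:ℝ) / 2)) := by
          rw [mul_assoc, ENNReal.ofReal_mul (by norm_num), ENNReal.ofReal_mul (by positivity)]
          simp only [ENNReal.ofReal_coe_nnreal, ENNReal.ofReal_ofNat]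
          ring
  rw [hmg.eLpNorm_eq_integral_rpow_norm (by exact_mod_cast ht0) (by simp),
    ENNReal.ofReal_le_ofReal_iff (by positivity)] at hG
  simpa using hG

end Helpers

theorem stmt10 (Ω : Set (EuclideanSpace ℝ (Fin 2)))
    (hΩ : IsOpen Ω) (hΩb : IsBounded Ω) (hsm : HasSmoothBoundary Ω)
    (t : ℝ) (ht : 2 < t) :
    ∃ c > (0 : ℝ), ∀ γ : ℝ, 0 ≤ γ →
      ∀ f u : EuclideanSpace ℝ (Fin 2) → ℝ,
        ContinuousOn f Ω → IntegrableOn (fun x => f x ^ 2) Ω →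
        (∀ x ∈ Ω, 0 ≤ f x) →
        ∀ U : Set (EuclideanSpace ℝ (Fin 2)),
          IsOpen U → closure Ω ⊆ U → ContDiffOn ℝ 4 u U →
          (∀ x ∈ frontier Ω, u x = 0) →
          (∀ x ∈ frontier Ω, gradient u x = 0) →
          (∀ x ∈ Ω, lap (lap u) x - γ * lap u x = f x) →
          (∫ x in Ω, ‖gradient u x‖ ^ t) ^ (1 / t) ≤
            c * diam Ω ^ (2 / t) * (∫ x in Ω, f x * u x) ^ ((1 : ℝ) / 2) := by
  rcases Ω.eq_empty_or_nonempty with rfl | hne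
  · refine ⟨1, one_pos, ?_⟩
    intro γ _ f u _ _ _ U _ _ _ _ _ _
    have h1 : 1 / t ≠ 0 := by positivity
    simp only [Measure.restrict_empty, integral_zero_measure]
    rw [Real.zero_rpow h1, Real.zero_rpow (by norm_num)]
    simp
  have hd : 0 < diam Ω := by
    refine Metric.diam_pos ?_ hΩb
    by_contra h
    rw [Set.not_nontrivial_iff] at h
    exact (hΩ.measure_pos volume hne).ne' (h.measure_zero _)
  obtain ⟨C, hC0, hC⟩ := final_bound hΩ hΩb t ht
  have hdp : 0 < diam Ω ^ (2 / t) := Real.rpow_pos_of_pos hd _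
  refine ⟨(C + 1) / diam Ω ^ (2 / t), by positivity, ?_⟩
  intro γ hγ f u _ _ hf0 U hU hsub hu h0 h1 he
  have h := hC γ hγ f u U hU hsub hu h0 h1 he
  have hA0 : 0 ≤ ∫ x in Ω, f x * u x := le_trans (integral_nonneg fun x => by positivity)
    (energy hγ hΩ hΩb hU hsub hu h0 h1 he 0)
  rw [div_mul_cancel₀ _ hdp.ne']
  refine h.trans ?_
  gcongr
  linarith
end

section
/- Let N ≥ 2, let Ω ⊂ ℝ^N be open and bounded with smooth boundary, let γ ≥ 0, and let f : Ω → ℝ be continuous and square-integrable. Let u be a classical solution: u is C⁴ on an open neighborhood of the closure of Ω, u = 0 and ∇u = 0 at every point of ∂Ω, and Δ²u(x) − γΔu(x) = f(x) for every x ∈ Ω. Then ( ∫_Ω (Δu)² dx )^{1/2} ≤ C_P² · ( ∫_Ω f² dx )^{1/2}, where C_P is the Poincaré constant of Ω (the best constant in ‖v‖_{L²(Ω)} ≤ C_P ‖∇v‖_{L²(Ω)} for v vanishing on ∂Ω); in particular the bound is independent of γ. -/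
open MeasureTheory Metric Set Bornology

/-- On a bounded open set, a `C¹` function vanishing on the boundary is bounded by
the distance to the complement, and its extension by zero is Lipschitz. -/
theorem aux_lip {N : ℕ} {Ω U : Set (EuclideanSpace ℝ (Fin N))}
    (hΩ : IsOpen Ω) (hΩb : IsBounded Ω) (hne : Ωᶜ.Nonempty)
    (hU : IsOpen U) (hUc : closure Ω ⊆ U) {w : EuclideanSpace ℝ (Fin N) → ℝ}
    (hw : ContDiffOn ℝ 1 w U) (hb : ∀ x ∈ frontier Ω, w x = 0) :
    ∃ M : NNReal, (∀ x ∈ Ω, |w x| ≤ M * infDist x Ωᶜ) ∧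
      LipschitzWith (2 * M) (Ω.indicator w) := by
  have hK : IsCompact (closure Ω) := hΩb.isCompact_closure
  have hfc : ContinuousOn (fderiv ℝ w) (closure Ω) :=
    (hw.continuousOn_fderiv_of_isOpen hU le_rfl).mono hUc
  obtain ⟨C, hC⟩ := hK.exists_bound_of_continuousOn hfc
  set M : NNReal := Real.toNNReal C with hM
  have hMb : ∀ x ∈ closure Ω, ‖fderiv ℝ w x‖ ≤ M := fun x hx =>
    (hC x hx).trans (Real.le_coe_toNNReal C)
  have hd : ∀ x ∈ closure Ω, DifferentiableAt ℝ w x := fun x hx =>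
    (hw.differentiableOn one_ne_zero).differentiableAt (hU.mem_nhds (hUc hx))
  have hpos : ∀ x ∈ Ω, 0 < infDist x Ωᶜ := fun x hx =>
    (hΩ.isClosed_compl.notMem_iff_infDist_pos hne).1 (by simpa using hx)
  have hball : ∀ x ∈ Ω, closedBall x (infDist x Ωᶜ) ⊆ closure Ω := fun x hx => by
    rw [← closure_ball x (hpos x hx).ne']
    exact closure_mono ball_infDist_compl_subset
  have hmv : ∀ x ∈ Ω, ∀ y ∈ closedBall x (infDist x Ωᶜ), |w y - w x| ≤ M * dist x y := by
    intro x hx y hy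
    have := (convex_closedBall x (infDist x Ωᶜ)).norm_image_sub_le_of_norm_fderiv_le (𝕜 := ℝ)
      (fun z hz => hd z (hball x hx hz)) (fun z hz => hMb z (hball x hx hz))
      (mem_closedBall_self (hpos x hx).le) hy
    rwa [Real.norm_eq_abs, ← dist_eq_norm, dist_comm y x] at this
  have h1 : ∀ x ∈ Ω, |w x| ≤ M * infDist x Ωᶜ := by
    intro x hx
    obtain ⟨z, hz, hzd⟩ := hΩ.isClosed_compl.exists_infDist_eq_dist hne x
    have hzb : z ∈ closedBall x (infDist x Ωᶜ) := by
      rw [mem_closedBall, dist_comm, hzd]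
    have hzf : z ∈ frontier Ω := by
      rw [hΩ.frontier_eq]; exact ⟨hball x hx hzb, hz⟩
    have := hmv x hx z hzb
    rwa [hb z hzf, zero_sub, abs_neg, ← hzd] at this
  refine ⟨M, h1, LipschitzWith.of_dist_le_mul ?_⟩
  have key : ∀ x ∈ Ω, ∀ y, |Ω.indicator w x - Ω.indicator w y| ≤ 2 * M * dist x y := by
    intro x hx y
    have hM0 : (0 : ℝ) ≤ M := M.coe_nonneg
    have hdn : 0 ≤ dist x y := dist_nonneg
    rw [indicator_of_mem hx]
    by_cases hy : y ∈ Ω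
    · rw [indicator_of_mem hy]
      by_cases hxy : dist x y ≤ infDist x Ωᶜ
      · have := hmv x hx y (by rwa [mem_closedBall, dist_comm])
        rw [abs_sub_comm]
        nlinarith [mul_nonneg hM0 hdn]
      · by_cases hyx : dist x y ≤ infDist y Ωᶜ
        · have := hmv y hy x (by rwa [mem_closedBall])
          rw [dist_comm y x] at this
          nlinarith [mul_nonneg hM0 hdn]
        · have a := h1 x hx
          have b := h1 y hy
          push Not at hxy hyx
          have c := abs_sub (w x) (w y)
          nlinarith [mul_le_mul_of_nonneg_left hxy.le hM0, mul_le_mul_of_nonneg_left hyx.le hM0]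
    · rw [indicator_of_notMem hy, sub_zero]
      have := infDist_le_dist_of_mem (x := x) (mem_compl hy)
      nlinarith [h1 x hx, mul_nonneg hM0 hdn, mul_le_mul_of_nonneg_left this hM0]
  intro x y
  rw [Real.dist_eq]
  push_cast
  by_cases hx : x ∈ Ω
  · exact key x hx y
  · by_cases hy : y ∈ Ω
    · rw [abs_sub_comm, dist_comm]; exact key y hy x
    · rw [indicator_of_notMem hx, indicator_of_notMem hy]
      simp only [sub_zero, abs_zero]; positivity

/-- Divergence theorem for a `C¹` function vanishing on the boundary. -/
theorem aux_int {N : ℕ} {Ω U : Set (EuclideanSpace ℝ (Fin N))}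
    (hΩ : IsOpen Ω) (hΩb : IsBounded Ω) (hne : Ωᶜ.Nonempty)
    (hU : IsOpen U) (hUc : closure Ω ⊆ U) {w : EuclideanSpace ℝ (Fin N) → ℝ}
    (hw : ContDiffOn ℝ 1 w U) (hb : ∀ x ∈ frontier Ω, w x = 0)
    (v : EuclideanSpace ℝ (Fin N)) :
    ∫ x in Ω, fderiv ℝ w x v = 0 := by
  obtain ⟨M, hM, hL⟩ := aux_lip hΩ hΩb hne hU hUc hw hb
  have hM0 : (0 : ℝ) ≤ M := M.coe_nonneg
  have hK : IsCompact (closure Ω) := hΩb.isCompact_closure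
  have hfin : volume Ω < ⊤ := hΩb.measure_lt_top
  have hpos : ∀ x ∈ Ω, 0 < infDist x Ωᶜ := fun x hx =>
    (hΩ.isClosed_compl.notMem_iff_infDist_pos hne).1 (by simpa using hx)
  have hdc : Continuous (fun x => infDist x Ωᶜ) := continuous_infDist_pt _
  let W := Ω.indicator w
  have hWs : HasCompactSupport W :=
    HasCompactSupport.intro hK (fun x hx => indicator_of_notMem (fun h => hx (subset_closure h)) _)
  let χ : ℕ → EuclideanSpace ℝ (Fin N) → ℝ := fun n x => min 1 ((n + 1 : ℝ) * infDist x Ωᶜ)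
  have hχL : ∀ n : ℕ, LipschitzWith (n + 1) (χ n) := by
    intro n
    refine LipschitzWith.const_min ?_ 1
    refine LipschitzWith.of_dist_le_mul fun x y => ?_
    have := (lipschitz_infDist_pt Ωᶜ).dist_le_mul x y
    rw [Real.dist_eq] at this ⊢
    rw [← mul_sub, abs_mul, abs_of_nonneg (by positivity : (0 : ℝ) ≤ n + 1)]
    push_cast at this ⊢
    gcongr
    simpa using this
  have hχ0 : ∀ n, ∀ x, 0 ≤ χ n x := fun n x => le_min zero_le_one (by have := infDist_nonneg (x := x) (s := Ωᶜ); positivity)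
  have hχ1 : ∀ n, ∀ x, χ n x ≤ 1 := fun n x => min_le_left _ _
  have hχc : ∀ n, ∀ x ∉ Ω, χ n x = 0 := by
    intro n x hx
    simp [χ, infDist_zero_of_mem (mem_compl hx)]
  have hbp : ∀ n, ∫ x, lineDeriv ℝ (χ n) x v * W x = ∫ x, lineDeriv ℝ W x (-v) * χ n x :=
    fun n => LipschitzWith.integral_lineDeriv_mul_eq (hχL n) hL hWs v
  -- eventually the distance exceeds `1 / (n+1)`
  have hev : ∀ x ∈ Ω, ∀ᶠ n : ℕ in Filter.atTop, 1 < (n + 1 : ℝ) * infDist x Ωᶜ := by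
    intro x hx
    have h0 := hpos x hx
    have : Filter.Tendsto (fun n : ℕ => ((n : ℝ) + 1) * infDist x Ωᶜ) Filter.atTop Filter.atTop :=
      (Filter.tendsto_atTop_add_const_right _ _ tendsto_natCast_atTop_atTop).atTop_mul_const h0
    exact this.eventually_gt_atTop 1
  have hloc : ∀ n : ℕ, ∀ x, 1 < (n + 1 : ℝ) * infDist x Ωᶜ → lineDeriv ℝ (χ n) x v = 0 := by
    intro n x hx
    have : χ n =ᶠ[nhds x] fun _ => (1 : ℝ) := by
      have ho : IsOpen {y | 1 < (n + 1 : ℝ) * infDist y Ωᶜ} :=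
        isOpen_lt continuous_const (continuous_const.mul hdc)
      filter_upwards [ho.mem_nhds hx] with y hy
      exact min_eq_left (le_of_lt hy)
    rw [this.lineDeriv_eq]
    simp [lineDeriv]
  have hL1 : ∀ n, ∫ x, lineDeriv ℝ (χ n) x v * W x = ∫ x in Ω, lineDeriv ℝ (χ n) x v * W x := by
    intro n
    refine (setIntegral_eq_integral_of_forall_compl_eq_zero fun x hx => ?_).symm
    simp [W, hx]
  have hL2 : ∀ n, ∫ x, lineDeriv ℝ W x (-v) * χ n x = ∫ x in Ω, lineDeriv ℝ W x (-v) * χ n x := by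
    intro n
    refine (setIntegral_eq_integral_of_forall_compl_eq_zero fun x hx => ?_).symm
    simp [hχc n x hx]
  have hT1 : Filter.Tendsto (fun n => ∫ x in Ω, lineDeriv ℝ (χ n) x v * W x) Filter.atTop
      (nhds (∫ x in Ω, (0 : ℝ))) := by
    refine MeasureTheory.tendsto_integral_of_dominated_convergence (fun _ => M * ‖v‖) ?_ ?_ ?_ ?_
    · intro n
      exact ((measurable_lineDeriv (hχL n).continuous).mul hL.continuous.measurable).aestronglyMeasurable
    · exact integrableOn_const hfin.ne
    · intro n
      refine (ae_restrict_iff' hΩ.measurableSet).2 (Filter.Eventually.of_forall fun x hx => ?_)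
      by_cases h : 1 < (n + 1 : ℝ) * infDist x Ωᶜ
      · rw [hloc n x h]; simp; positivity
      · push Not at h
        have h2 := norm_lineDeriv_le_of_lipschitz ℝ (hχL n) (x₀ := x) (v := v)
        have h3 := hM x hx
        have : W x = w x := indicator_of_mem hx _
        rw [norm_mul, this, Real.norm_eq_abs (w x)]
        push_cast at h2
        calc _ ≤ ((n + 1 : ℝ) * ‖v‖) * (M * infDist x Ωᶜ) := by gcongr
          _ = (M * ‖v‖) * ((n + 1 : ℝ) * infDist x Ωᶜ) := by ring
          _ ≤ (M * ‖v‖) * 1 := by gcongr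
          _ = _ := mul_one _
    · refine (ae_restrict_iff' hΩ.measurableSet).2 (Filter.Eventually.of_forall fun x hx => ?_)
      refine tendsto_const_nhds.congr' ?_
      filter_upwards [hev x hx] with n hn
      rw [hloc n x hn, zero_mul]
  have hT2 : Filter.Tendsto (fun n => ∫ x in Ω, lineDeriv ℝ W x (-v) * χ n x) Filter.atTop
      (nhds (∫ x in Ω, lineDeriv ℝ W x (-v))) := by
    refine MeasureTheory.tendsto_integral_of_dominated_convergence
      (fun _ => (2 * M : NNReal) * ‖-v‖) ?_ ?_ ?_ ?_
    · intro n
      exact ((measurable_lineDeriv hL.continuous).mul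
        (hχL n).continuous.measurable).aestronglyMeasurable
    · exact integrableOn_const hfin.ne
    · intro n
      refine Filter.Eventually.of_forall fun x => ?_
      have h2 := norm_lineDeriv_le_of_lipschitz ℝ hL (x₀ := x) (v := -v)
      rw [norm_mul, Real.norm_of_nonneg (hχ0 n x)]
      calc _ ≤ ‖lineDeriv ℝ W x (-v)‖ * 1 := by gcongr; exact hχ1 n x
        _ ≤ _ := by rw [mul_one]; exact h2
    · refine (ae_restrict_iff' hΩ.measurableSet).2 (Filter.Eventually.of_forall fun x hx => ?_)
      refine tendsto_const_nhds.congr' ?_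
      filter_upwards [hev x hx] with n hn
      simp [χ, min_eq_left hn.le]
  have hfinal : ∫ x in Ω, lineDeriv ℝ W x (-v) = 0 := by
    have := tendsto_nhds_unique hT2 (hT1.congr fun n => by rw [← hL1, hbp, hL2])
    simpa using this
  have hptw : ∫ x in Ω, lineDeriv ℝ W x (-v) = ∫ x in Ω, -(fderiv ℝ w x v) := by
    refine setIntegral_congr_fun hΩ.measurableSet fun x hx => ?_
    have : W =ᶠ[nhds x] w := by
      filter_upwards [hΩ.mem_nhds hx] with y hy
      exact indicator_of_mem hy _
    have hd : DifferentiableAt ℝ w x :=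
      (hw.differentiableOn one_ne_zero).differentiableAt (hU.mem_nhds (hUc (subset_closure hx)))
    simp only [this.lineDeriv_eq, hd.lineDeriv_eq_fderiv, map_neg]
  rw [hptw, integral_neg] at hfinal
  linarith

theorem aux_pd {N : ℕ} {U : Set (EuclideanSpace ℝ (Fin N))} (hU : IsOpen U)
    {u : EuclideanSpace ℝ (Fin N) → ℝ} {m n : WithTop ℕ∞} (hmn : m + 1 ≤ n)
    (hu : ContDiffOn ℝ n u U) (i : Fin N) : ContDiffOn ℝ m (pd i u) U :=
  (hu.fderiv_of_isOpen hU hmn).clm_apply contDiffOn_const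

theorem aux_lap {N : ℕ} {U : Set (EuclideanSpace ℝ (Fin N))} (hU : IsOpen U)
    {u : EuclideanSpace ℝ (Fin N) → ℝ} {k m n : WithTop ℕ∞} (hkm : k + 1 ≤ m) (hmn : m + 1 ≤ n)
    (hu : ContDiffOn ℝ n u U) : ContDiffOn ℝ k (lap u) U :=
  ContDiffOn.sum fun i _ => aux_pd hU hkm (aux_pd hU hmn hu i) i

theorem aux_integrable {N : ℕ} {Ω U : Set (EuclideanSpace ℝ (Fin N))}
    (hΩb : IsBounded Ω) (hUc : closure Ω ⊆ U) {g : EuclideanSpace ℝ (Fin N) → ℝ}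
    (hg : ContinuousOn g U) : IntegrableOn g Ω :=
  ((hg.mono hUc).integrableOn_compact hΩb.isCompact_closure).mono_set subset_closure

theorem aux_integrable_mul {N : ℕ} {Ω U : Set (EuclideanSpace ℝ (Fin N))}
    (hΩb : IsBounded Ω) (hUc : closure Ω ⊆ U) {g h : EuclideanSpace ℝ (Fin N) → ℝ}
    (hg : ContinuousOn g U) (hh : ContinuousOn h U) : IntegrableOn (fun x => g x * h x) Ω :=
  aux_integrable hΩb hUc (hg.mul hh)

/-- Integration by parts. -/
theorem aux_ibp {N : ℕ} {Ω U : Set (EuclideanSpace ℝ (Fin N))}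
    (hΩ : IsOpen Ω) (hΩb : IsBounded Ω) (hne : Ωᶜ.Nonempty)
    (hU : IsOpen U) (hUc : closure Ω ⊆ U) {a b : EuclideanSpace ℝ (Fin N) → ℝ}
    (ha : ContDiffOn ℝ 1 a U) (hb : ContDiffOn ℝ 1 b U) (h0 : ∀ x ∈ frontier Ω, a x = 0)
    (i : Fin N) :
    ∫ x in Ω, a x * pd i b x = - ∫ x in Ω, pd i a x * b x := by
  have h := aux_int hΩ hΩb hne hU hUc (ha.mul hb)
    (fun x hx => by simp [h0 x hx]) (EuclideanSpace.single i 1)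
  have hpa : ContinuousOn (pd i a) U := (aux_pd (m := 0) hU (by simp) ha i).continuousOn
  have hpb : ContinuousOn (pd i b) U := (aux_pd (m := 0) hU (by simp) hb i).continuousOn
  have e : ∫ x in Ω, fderiv ℝ (a * b) x (EuclideanSpace.single i 1)
      = ∫ x in Ω, (a x * pd i b x + pd i a x * b x) := by
    refine setIntegral_congr_fun hΩ.measurableSet fun x hx => ?_
    have hx' := hU.mem_nhds (hUc (subset_closure hx))
    have hda : DifferentiableAt ℝ a x := (ha.differentiableOn one_ne_zero).differentiableAt hx'
    have hdb : DifferentiableAt ℝ b x := (hb.differentiableOn one_ne_zero).differentiableAt hx'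
    simp only [fderiv_mul hda hdb, pd]
    simp
    ring
  have h' : ∫ x in Ω, fderiv ℝ (a * b) x (EuclideanSpace.single i 1) = 0 := h
  rw [e, integral_add (aux_integrable_mul hΩb hUc ha.continuousOn hpb)
    (aux_integrable_mul hΩb hUc hpa hb.continuousOn)] at h'
  linarith

/-- The Cauchy-Schwarz inequality. -/
theorem aux_cs {N : ℕ} {Ω : Set (EuclideanSpace ℝ (Fin N))}
    {a b : EuclideanSpace ℝ (Fin N) → ℝ}
    (ha : IntegrableOn (fun x => a x ^ 2) Ω) (hb : IntegrableOn (fun x => b x ^ 2) Ω)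
    (hab : IntegrableOn (fun x => a x * b x) Ω) :
    |∫ x in Ω, a x * b x| ≤ √(∫ x in Ω, a x ^ 2) * √(∫ x in Ω, b x ^ 2) := by
  have hd := discrim_le_zero (a := ∫ x in Ω, b x ^ 2) (b := 2 * ∫ x in Ω, a x * b x)
    (c := ∫ x in Ω, a x ^ 2) (fun t => by
      have h : 0 ≤ ∫ x in Ω, (a x + t * b x) ^ 2 := integral_nonneg fun x => sq_nonneg _
      have e : ∀ x, (a x + t * b x) ^ 2 = (t * t) * b x ^ 2 + (2 * t) * (a x * b x) + a x ^ 2 :=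
        fun x => by ring
      simp only [e] at h
      have hs : IntegrableOn (fun x => (t * t) * b x ^ 2 + (2 * t) * (a x * b x)) Ω :=
        (hb.const_mul _).add (hab.const_mul _)
      rw [integral_add hs ha,
        integral_add (hb.const_mul _) (hab.const_mul _), integral_const_mul,
        integral_const_mul] at h
      linarith)
  rw [← Real.sqrt_mul (integral_nonneg fun x => sq_nonneg _)]
  apply Real.abs_le_sqrt
  rw [discrim] at hd
  nlinarith

theorem aux_grad {N : ℕ} (u : EuclideanSpace ℝ (Fin N) → ℝ) (x : EuclideanSpace ℝ (Fin N))
    (i : Fin N) : gradient u x i = pd i u x := by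
  rw [pd, ← inner_gradient_left (𝕜 := ℝ), EuclideanSpace.inner_single_right]
  simp

/-- The a priori `L²` estimate `‖Δu‖_{L²} ≤ C_P² ‖f‖_{L²}` for classical solutions of
`Δ²u − γΔu = f` with Dirichlet boundary conditions, uniform in `γ ≥ 0`. Here `C_P` is any
Poincaré constant for `Ω`: `‖v‖_{L²} ≤ C_P ‖∇v‖_{L²}` for `v` vanishing on `∂Ω`. -/
theorem stmt16 (N : ℕ) (hN : 2 ≤ N)
    (Ω : Set (EuclideanSpace ℝ (Fin N)))
    (hΩ : IsOpen Ω) (hΩb : IsBounded Ω) (hsm : HasSmoothBoundary Ω)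
    (γ : ℝ) (hγ : 0 ≤ γ)
    (f : EuclideanSpace ℝ (Fin N) → ℝ)
    (hfc : ContinuousOn f Ω) (hf2 : IntegrableOn (fun x => f x ^ 2) Ω)
    (CP : ℝ) (hCP0 : 0 ≤ CP)
    (hCP : ∀ v : EuclideanSpace ℝ (Fin N) → ℝ,
      ∀ V : Set (EuclideanSpace ℝ (Fin N)),
        IsOpen V → closure Ω ⊆ V → ContDiffOn ℝ 1 v V →
        (∀ x ∈ frontier Ω, v x = 0) →
        (∫ x in Ω, v x ^ 2) ^ ((1 : ℝ) / 2) ≤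
          CP * (∫ x in Ω, ‖gradient v x‖ ^ 2) ^ ((1 : ℝ) / 2))
    (u : EuclideanSpace ℝ (Fin N) → ℝ)
    (U : Set (EuclideanSpace ℝ (Fin N)))
    (hU : IsOpen U) (hUc : closure Ω ⊆ U) (hu : ContDiffOn ℝ 4 u U)
    (hub : ∀ x ∈ frontier Ω, u x = 0)
    (hgb : ∀ x ∈ frontier Ω, gradient u x = 0)
    (heq : ∀ x ∈ Ω, lap (lap u) x - γ * lap u x = f x) :
    (∫ x in Ω, (lap u x) ^ 2) ^ ((1 : ℝ) / 2) ≤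
      CP ^ 2 * (∫ x in Ω, f x ^ 2) ^ ((1 : ℝ) / 2) := by
  have hne : Ωᶜ.Nonempty := by
    rw [nonempty_compl]
    rintro rfl
    have : Nonempty (Fin N) := ⟨⟨0, by omega⟩⟩
    exact NormedSpace.unbounded_univ ℝ (EuclideanSpace ℝ (Fin N)) hΩb
  have hu1 : ContDiffOn ℝ 1 u U := hu.of_le (by norm_num)
  have hpd1 : ∀ i, ContDiffOn ℝ 1 (pd i u) U := fun i =>
    (aux_pd hU (m := 3) (by norm_num) hu i).of_le (by norm_num)
  have hL2 : ContDiffOn ℝ 2 (lap u) U := aux_lap hU (m := 3) (by norm_num) (by norm_num) hu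
  have hL1 : ContDiffOn ℝ 1 (lap u) U := hL2.of_le (by norm_num)
  have hpL : ∀ i, ContDiffOn ℝ 1 (pd i (lap u)) U := fun i =>
    aux_pd hU (by norm_num) hL2 i
  have hLL : ContinuousOn (lap (lap u)) U :=
    (aux_lap hU (k := 0) (m := 1) (by norm_num) (by norm_num) hL2).continuousOn
  have hpdb : ∀ i, ∀ x ∈ frontier Ω, pd i u x = 0 := fun i x hx => by
    rw [← aux_grad, hgb x hx]; simp
  have hint : ∀ {g : EuclideanSpace ℝ (Fin N) → ℝ}, ContinuousOn g U → IntegrableOn g Ω :=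
    fun hg => aux_integrable hΩb hUc hg
  have hm : ∀ {g h : EuclideanSpace ℝ (Fin N) → ℝ}, ContinuousOn g U → ContinuousOn h U →
      IntegrableOn (fun x => g x * h x) Ω :=
    fun hg hh => aux_integrable_mul hΩb hUc hg hh
  have cpp : ∀ i, ContinuousOn (pd i (pd i u)) U := fun i =>
    (aux_pd (m := 0) hU (by simp) (hpd1 i) i).continuousOn
  have cppL : ∀ i, ContinuousOn (pd i (pd i (lap u))) U := fun i =>
    (aux_pd (m := 0) hU (by simp) (hpL i) i).continuousOn
  have cu := hu.continuousOn
  have cL := hL1.continuousOn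
  -- gradient identity
  have hG : ∫ x in Ω, ‖gradient u x‖ ^ 2 = - ∫ x in Ω, u x * lap u x := by
    have e1 : ∀ x, ‖gradient u x‖ ^ 2 = ∑ i, pd i u x * pd i u x := fun x => by
      rw [EuclideanSpace.norm_sq_eq]
      refine Finset.sum_congr rfl fun i _ => ?_
      rw [aux_grad, Real.norm_eq_abs, sq_abs, sq]
    simp only [e1, lap, Finset.mul_sum]
    rw [integral_finsetSum _ fun i _ => hm (hpd1 i).continuousOn (hpd1 i).continuousOn,
      integral_finsetSum _ fun i _ => hm cu (cpp i), ← Finset.sum_neg_distrib]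
    refine Finset.sum_congr rfl fun i _ => ?_
    rw [aux_ibp hΩ hΩb hne hU hUc hu1 (hpd1 i) hub i, neg_neg]
  -- biharmonic identity
  have hB : ∫ x in Ω, u x * lap (lap u) x = ∫ x in Ω, lap u x ^ 2 := by
    have e1 : ∀ x, u x * lap (lap u) x = ∑ i, u x * pd i (pd i (lap u)) x := fun x => by
      rw [← Finset.mul_sum]; rfl
    have e2 : ∀ x, lap u x ^ 2 = ∑ i, pd i (pd i u) x * lap u x := fun x => by
      rw [← Finset.sum_mul, sq]; rfl
    simp only [e1, e2]
    rw [integral_finsetSum _ fun i _ => hm cu (cppL i),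
      integral_finsetSum _ fun i _ => hm (cpp i) cL]
    refine Finset.sum_congr rfl fun i _ => ?_
    rw [aux_ibp hΩ hΩb hne hU hUc hu1 (hpL i) hub i,
      aux_ibp hΩ hΩb hne hU hUc (hpd1 i) hL1 (hpdb i) i, neg_neg]
  have hfu : ∀ x ∈ Ω, f x * u x = u x * lap (lap u) x - γ * (u x * lap u x) := fun x hx => by
    rw [← heq x hx]; ring
  have hfi : IntegrableOn (fun x => f x * u x) Ω := by
    refine IntegrableOn.congr_fun (f := fun x => u x * lap (lap u) x - γ * (u x * lap u x))
      (hint ?_) (fun x hx => (hfu x hx).symm) hΩ.measurableSet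
    exact (cu.mul hLL).sub (continuousOn_const.mul (cu.mul cL))
  have hE : ∫ x in Ω, f x * u x = (∫ x in Ω, lap u x ^ 2) + γ * ∫ x in Ω, ‖gradient u x‖ ^ 2 := by
    rw [setIntegral_congr_fun hΩ.measurableSet hfu,
      integral_sub (hm cu hLL) ((hm cu cL).const_mul _), integral_const_mul, hB, hG]
    ring
  have hP := hCP u U hU hUc hu1 hub
  have c1 := aux_cs hf2 (hint (cu.pow 2)) hfi
  have c2 := aux_cs (hint (cu.pow 2)) (hint (cL.pow 2)) (hm cu cL)
  simp only [← Real.sqrt_eq_rpow] at hP ⊢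
  have hGn : 0 ≤ ∫ x in Ω, ‖gradient u x‖ ^ 2 := integral_nonneg fun x => sq_nonneg _
  have hLn : 0 ≤ ∫ x in Ω, lap u x ^ 2 := integral_nonneg fun x => sq_nonneg _
  rw [hE] at c1
  have c1' := (le_abs_self _).trans c1
  have c2' := (neg_le_abs _).trans c2
  rw [← hG] at c2'
  have hγG := mul_nonneg hγ hGn
  have sG := Real.mul_self_sqrt hGn
  have sL := Real.mul_self_sqrt hLn
  set G := √(∫ x in Ω, ‖gradient u x‖ ^ 2)
  set L := √(∫ x in Ω, lap u x ^ 2)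
  set F := √(∫ x in Ω, f x ^ 2)
  set A := √(∫ x in Ω, u x ^ 2)
  have G0 : 0 ≤ G := Real.sqrt_nonneg _
  have L0 : 0 ≤ L := Real.sqrt_nonneg _
  have F0 : 0 ≤ F := Real.sqrt_nonneg _
  have k1 : G ≤ CP * L := by
    by_contra h
    push Not at h
    have hGpos : 0 < G := lt_of_le_of_lt (mul_nonneg hCP0 L0) h
    nlinarith [mul_le_mul_of_nonneg_right hP L0, mul_lt_mul_of_pos_left h hGpos]
  have k2 : A ≤ CP ^ 2 * L := by
    nlinarith [mul_le_mul_of_nonneg_left k1 hCP0]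
  have k3 : L * L ≤ (CP ^ 2 * F) * L := by
    nlinarith [mul_le_mul_of_nonneg_left k2 F0]
  by_contra h
  push Not at h
  have hLpos : 0 < L := lt_of_le_of_lt (by positivity) h
  nlinarith [mul_lt_mul_of_pos_right h hLpos]
end
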